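/- arXiv:1204.2495 — 7 statements merged into one kernel-verified Lean document; each statement's English description precedes it below -/
import Mathlib

section
/- Let n, k ∈ ℕ and let ζ be an (n,k)-constraint with n > 2k. Then for every set S ⊆ [n] of rows, the set of columns reachable from S through allowed positions, namely N(S) = {c ∈ [n] : ∃ r ∈ S with (r,c) ∉ ζ}, satisfies |N(S)| ≥ |S|. (This is Hall's condition for the bipartite graph whose edges are the positions of [n] × [n] not forbidden by ζ.) -/
/-- **Hall's condition for (n,k)-constraints.**
An `(n,k)`-constraint is a set `ζ ⊆ [n] × [n]` (here `[n] = Finset.Icc 1 n`)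
with at most `k` elements in each row and at most `k` elements in each column.
If `n > 2k`, then for every set `S ⊆ [n]` of rows, the set
`N(S) = {c ∈ [n] : ∃ r ∈ S, (r,c) ∉ ζ}` of columns reachable from `S`
through allowed positions satisfies `|N(S)| ≥ |S|`. -/
theorem hall_condition_for_constraints
    (n k : ℕ) (hnk : n > 2 * k)
    (ζ : Finset (ℕ × ℕ))
    (hζ : ζ ⊆ Finset.Icc 1 n ×ˢ Finset.Icc 1 n)
    (hrow : ∀ r, (ζ.filter (fun p => p.1 = r)).card ≤ k)
    (hcol : ∀ c, (ζ.filter (fun p => p.2 = c)).card ≤ k)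
    (S : Finset ℕ) (hS : S ⊆ Finset.Icc 1 n) :
    S.card ≤ ((Finset.Icc 1 n).filter (fun c => ∃ r ∈ S, (r, c) ∉ ζ)).card := by
  rcases S.eq_empty_or_nonempty with rfl | ⟨r, hr⟩
  · simp
  rcases le_or_gt S.card k with hSk | hSk
  · have hforbidden : ((Finset.Icc 1 n).filter (fun c => (r, c) ∈ ζ)).card ≤ k := by
      refine le_trans (Finset.card_le_card_of_injOn (fun c => (r, c)) ?_ ?_) (hrow r)
      · intro c hc
        simp_all
      · intro a _ b _ hab
        simpa using hab
    have hallowed : ((Finset.Icc 1 n).filter (fun c => ¬ (r, c) ∈ ζ)).card ≤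
        ((Finset.Icc 1 n).filter (fun c => ∃ r ∈ S, (r, c) ∉ ζ)).card :=
      Finset.card_le_card (Finset.monotone_filter_right _ fun c _ hc => ⟨r, hr, hc⟩)
    have hsplit := Finset.card_filter_add_card_filter_not
      (s := Finset.Icc 1 n) (fun c => (r, c) ∈ ζ)
    rw [Nat.card_Icc] at hsplit
    omega
  · rw [Finset.filter_true_of_mem]
    · exact Finset.card_le_card hS
    · intro c _
      by_contra! hc
      refine hSk.not_ge (le_trans
        (Finset.card_le_card_of_injOn (fun r => (r, c)) ?_ ?_) (hcol c))
      · intro a ha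
        simp_all
      · intro a _ b _ hab
        simpa using hab
end

section
/- For every (n,k)-constraint ζ with n > 2k, there exists an n-permutation π that satisfies ζ; that is, there is a bijection π : [n] → [n] such that (r, π(r)) ∉ ζ for every r ∈ [n]. -/
/-- If every row and column of the finite relation `ζ` has at most `k` elements and `C` has at least
`2 * k` elements, then any set `s` of at most `#C` rows satisfies Hall's condition for the
complement of `ζ` in `C`. -/
theorem card_le_card_biUnion_filter_notMem {α β : Type*} [DecidableEq α] [DecidableEq β]
    {k : ℕ} {ζ : Finset (α × β)} {C : Finset β} (hC : 2 * k ≤ C.card)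
    (hrow : ∀ r, (ζ.filter (fun p => p.1 = r)).card ≤ k)
    (hcol : ∀ c, (ζ.filter (fun p => p.2 = c)).card ≤ k)
    (s : Finset α) (hs : s.card ≤ C.card) :
    s.card ≤ (s.biUnion fun r => C.filter fun c => (r, c) ∉ ζ).card := by
  rcases s.eq_empty_or_nonempty with rfl | ⟨r, hr⟩
  · simp
  rcases le_or_gt s.card k with hsk | hsk
  · have hsub : (C.filter fun c => (r, c) ∉ ζ) ⊆
        s.biUnion fun r => C.filter fun c => (r, c) ∉ ζ :=
      Finset.subset_biUnion_of_mem (fun r => C.filter fun c => (r, c) ∉ ζ) hr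
    have hforb : (C.filter fun c => (r, c) ∈ ζ).card ≤ k :=
      (Finset.card_le_card_of_injOn (fun c => (r, c)) (fun c hc => by simp_all)
        (fun a _ b _ h => (Prod.mk.inj h).2)).trans (hrow r)
    have hsum := C.card_filter_add_card_filter_not (fun c => (r, c) ∈ ζ)
    have hle := Finset.card_le_card hsub
    omega
  · refine hs.trans (Finset.card_le_card fun c hc => ?_)
    by_contra hcon
    have hall : ∀ r ∈ s, (r, c) ∈ ζ := by simpa [hc] using hcon
    have hle : s.card ≤ k :=
      (Finset.card_le_card_of_injOn (fun r => (r, c)) (fun r hr => by simp_all)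
        (fun a _ b _ h => (Prod.mk.inj h).1)).trans (hcol c)
    omega

/-- For every `(n,k)`-constraint `ζ` with `n > 2k`, there is an `n`-permutation
satisfying `ζ`: a bijection `π : [n] → [n]` (with `[n] = Finset.Icc 1 n`)
such that `(r, π r) ∉ ζ` for every `r ∈ [n]`. -/
theorem exists_permutation_satisfying_constraint
    (n k : ℕ) (hnk : n > 2 * k)
    (ζ : Finset (ℕ × ℕ))
    (hζ : ζ ⊆ Finset.Icc 1 n ×ˢ Finset.Icc 1 n)
    (hrow : ∀ r, (ζ.filter (fun p => p.1 = r)).card ≤ k)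
    (hcol : ∀ c, (ζ.filter (fun p => p.2 = c)).card ≤ k) :
    ∃ π : ℕ → ℕ, Set.BijOn π (Set.Icc 1 n) (Set.Icc 1 n) ∧
      ∀ r ∈ Set.Icc 1 n, (r, π r) ∉ ζ := by
  obtain ⟨f, hinj, hf⟩ := (Finset.all_card_le_biUnion_card_iff_exists_injective
    (fun r : Finset.Icc 1 n => (Finset.Icc 1 n).filter fun c => ((r : ℕ), c) ∉ ζ)).mp fun s => by
      have h := card_le_card_biUnion_filter_notMem (C := Finset.Icc 1 n) (by simp; omega) hrow hcol
        (s.map (Function.Embedding.subtype _))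
        (Finset.card_le_card (Finset.map_subtype_subset s))
      rwa [Finset.card_map, Finset.map_eq_image, Finset.image_biUnion] at h
  simp only [Finset.mem_filter] at hf
  let π : ℕ → ℕ := fun r => if hr : r ∈ Finset.Icc 1 n then f ⟨r, hr⟩ else r
  have hπ : ∀ r (hr : r ∈ Finset.Icc 1 n), π r = f ⟨r, hr⟩ := fun r hr => dif_pos hr
  have hmaps : Set.MapsTo π (Finset.Icc 1 n) (Finset.Icc 1 n) := fun r hr => by
    rw [hπ r hr]
    exact (hf _).1
  have hinjOn : Set.InjOn π (Finset.Icc 1 n) := fun a ha b hb hab => by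
    rw [hπ a ha, hπ b hb] at hab
    exact congrArg Subtype.val (hinj hab)
  rw [← Finset.coe_Icc]
  refine ⟨π, ⟨hmaps, hinjOn, Finset.surjOn_of_injOn_of_card_le π hmaps hinjOn le_rfl⟩,
    fun r hr => ?_⟩
  rw [hπ r hr]
  exact (hf ⟨r, hr⟩).2
end

section
/- For every (n,4)-constraint ζ with n ≥ 9, there exists an n-permutation π that satisfies ζ; that is, there is a bijection π : [n] → [n] such that (r, π(r)) ∉ ζ for every r ∈ [n]. -/
/-- If every row and every column of `ζ` has at most `k` elements and `2 * k ≤ #s`, then some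
injection of `s` into itself avoids `ζ`. -/
theorem exists_injOn_mapsTo_avoiding {α : Type*} [DecidableEq α] (s : Finset α)
    (ζ : Finset (α × α)) (k : ℕ) (hk : 2 * k ≤ s.card)
    (hrow : ∀ r, (ζ.filter (fun p => p.1 = r)).card ≤ k)
    (hcol : ∀ c, (ζ.filter (fun p => p.2 = c)).card ≤ k) :
    ∃ π : α → α, Set.InjOn π s ∧ Set.MapsTo π s s ∧ ∀ r ∈ s, (r, π r) ∉ ζ := by
  let t : s → Finset α := fun a => s.filter (fun c => (a.1, c) ∉ ζ)
  have hall : ∀ A : Finset s, A.card ≤ (A.biUnion t).card := by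
    intro A
    have hA : A.card ≤ s.card := by simpa using A.card_le_univ
    by_cases hAk : A.card ≤ k
    · obtain rfl | ⟨a, ha⟩ := A.eq_empty_or_nonempty
      · simp
      have h_bad : (s.filter (fun c => (a.1, c) ∈ ζ)).card ≤ k := by
        refine le_trans (Finset.card_le_card_of_injOn (fun c => (a.1, c)) ?_ ?_) (hrow a.1)
        · intro c hc
          simp_all
        · intro c _ d _ h
          simpa using h
      have h_split := s.card_filter_add_card_filter_not (fun c => (a.1, c) ∈ ζ)
      have h_le : (t a).card ≤ (A.biUnion t).card :=
        Finset.card_le_card (Finset.subset_biUnion_of_mem t ha)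
      change (s.filter (fun c => (a.1, c) ∉ ζ)).card ≤ _ at h_le
      omega
    · refine hA.trans (Finset.card_le_card fun c hc => ?_)
      by_contra h
      have h_all : ∀ a ∈ A, (a.1, c) ∈ ζ := by
        intro a ha
        by_contra h_mem
        exact h (Finset.mem_biUnion.2 ⟨a, ha, Finset.mem_filter.2 ⟨hc, h_mem⟩⟩)
      refine hAk (le_trans (Finset.card_le_card_of_injOn (fun a => (a.1, c)) ?_ ?_) (hcol c))
      · intro a ha
        simpa using h_all a ha
      · intro a _ b _ h_eq
        exact Subtype.ext (congrArg Prod.fst h_eq)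
  obtain ⟨f, hf, hft⟩ := (Finset.all_card_le_biUnion_card_iff_exists_injective t).1 hall
  refine ⟨fun a => if h : a ∈ s then f ⟨a, h⟩ else a, ?_, ?_, ?_⟩
  · intro a ha b hb h
    rw [Finset.mem_coe] at ha hb
    simp only [ha, hb, dite_true] at h
    exact congrArg Subtype.val (hf h)
  · intro a ha
    rw [Finset.mem_coe] at ha
    simpa [ha] using (Finset.mem_filter.1 (hft ⟨a, ha⟩)).1
  · intro a ha
    simpa [ha] using (Finset.mem_filter.1 (hft ⟨a, ha⟩)).2

/-- For every `(n,4)`-constraint `ζ` with `n ≥ 9`, there is an `n`-permutation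
satisfying `ζ`: a bijection `π : [n] → [n]` (with `[n] = Finset.Icc 1 n`)
such that `(r, π r) ∉ ζ` for every `r ∈ [n]`. -/
theorem exists_permutation_satisfying_n4_constraint
    (n : ℕ) (hn : 9 ≤ n)
    (ζ : Finset (ℕ × ℕ))
    (hζ : ζ ⊆ Finset.Icc 1 n ×ˢ Finset.Icc 1 n)
    (hrow : ∀ r, (ζ.filter (fun p => p.1 = r)).card ≤ 4)
    (hcol : ∀ c, (ζ.filter (fun p => p.2 = c)).card ≤ 4) :
    ∃ π : ℕ → ℕ, Set.BijOn π (Set.Icc 1 n) (Set.Icc 1 n) ∧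
      ∀ r ∈ Set.Icc 1 n, (r, π r) ∉ ζ := by
  obtain ⟨π, h_inj, h_maps, h_avoid⟩ :=
    exists_injOn_mapsTo_avoiding (Finset.Icc 1 n) ζ 4 (by rw [Nat.card_Icc]; omega) hrow hcol
  have h_surj := Finset.surjOn_of_injOn_of_card_le π h_maps h_inj le_rfl
  rw [Finset.coe_Icc] at h_inj h_maps h_surj
  exact ⟨π, ⟨h_maps, h_inj, h_surj⟩, fun r hr => h_avoid r (Finset.mem_Icc.2 hr)⟩
end

section
/- Let S, T ⊆ ℕ be finite sets with |S| = |T| = n and n ≥ 18, and let ζ ⊆ S × T be a set of forbidden positions containing at most 4 elements in each row and at most 4 elements in each column, i.e., |{c : (r,c) ∈ ζ}| ≤ 4 for every r ∈ S and |{r : (r,c) ∈ ζ}| ≤ 4 for every c ∈ T. Then there exists a bijection f : S → T such that (s, f(s)) ∉ ζ for every s ∈ S, and moreover there are no two distinct s, s' ∈ S with |s − s'| = 1 and |f(s) − f(s')| = 1. -/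
/-- Two natural numbers are consecutive, in either order. -/
def Consecutive (a b : ℕ) : Prop := a = b + 1 ∨ b = a + 1

theorem consecutive_of_abs_sub_eq_one {a b : ℕ} (h : |(a : ℤ) - (b : ℤ)| = 1) :
    Consecutive a b := by
  unfold Consecutive
  rcases (abs_eq zero_le_one).1 h with h | h <;> omega

theorem Consecutive.symm {a b : ℕ} (h : Consecutive a b) : Consecutive b a := Or.symm h

theorem Consecutive.eq_add_one_or_eq_sub_one {a b : ℕ} (h : Consecutive a b) :
    a = b + 1 ∨ a = b - 1 := by
  unfold Consecutive at h
  omega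

/-- The position `(s, f s)` is forbidden or diagonally adjacent to another point of the graph
of `f` on `S`. -/
def IsConflict (S : Finset ℕ) (ζ : Finset (ℕ × ℕ)) (f : ℕ → ℕ) (s : ℕ) : Prop :=
  (s, f s) ∈ ζ ∨ ∃ s' ∈ S, Consecutive s s' ∧ Consecutive (f s) (f s')

section SwapCandidates

variable {S T : Finset ℕ} {ζ : Finset (ℕ × ℕ)} {f : ℕ → ℕ} {s : ℕ}

open Classical in
theorem card_filter_row_forbidden_le (hf : Set.InjOn f S)
    (hrow : (ζ.filter (fun p => p.1 = s)).card ≤ 4) :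
    (S.filter (fun t => (s, f t) ∈ ζ)).card ≤ 4 := by
  refine (Finset.card_le_card_of_injOn (fun t => (s, f t)) ?_ ?_).trans hrow
  · intro t ht
    simp_all
  · intro t ht u hu h
    simp only [Finset.coe_filter, Set.mem_ofPred_eq] at ht hu
    exact hf ht.1 hu.1 (Prod.ext_iff.1 h).2

open Classical in
theorem card_filter_col_forbidden_le {c : ℕ}
    (hcol : (ζ.filter (fun p => p.2 = c)).card ≤ 4) :
    (S.filter (fun t => (t, c) ∈ ζ)).card ≤ 4 := by
  refine (Finset.card_le_card_of_injOn (fun t => (t, c)) ?_ ?_).trans hcol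
  · intro t ht
    simp_all
  · intro t _ u _ h
    exact (Prod.ext_iff.1 h).1

open Classical in
theorem card_filter_row_adjacent_le (hf : Set.InjOn f S) :
    (S.filter (fun t => ∃ s' ∈ S, Consecutive s s' ∧ Consecutive (f t) (f s'))).card ≤ 4 := by
  refine (Finset.card_le_card_of_injOn (t := {f (s + 1) + 1, f (s + 1) - 1, f (s - 1) + 1,
    f (s - 1) - 1}) f ?_ (hf.mono fun t ht => ?_)).trans Finset.card_le_four
  · intro t ht
    simp only [Finset.coe_filter, Set.mem_ofPred_eq] at ht
    obtain ⟨_, s', _, h₁, h₂⟩ := ht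
    have h₃ := h₂.eq_add_one_or_eq_sub_one
    rcases h₁.symm.eq_add_one_or_eq_sub_one with rfl | rfl <;>
      simp only [Finset.coe_insert, Finset.coe_singleton, Set.mem_insert_iff,
        Set.mem_singleton_iff] <;> tauto
  · exact Finset.mem_coe.2 (Finset.mem_filter.1 (Finset.mem_coe.1 ht)).1

open Classical in
theorem card_filter_col_adjacent_le {c : ℕ} (hf : Set.InjOn f S) :
    (S.filter (fun t => ∃ s' ∈ S, Consecutive t s' ∧ Consecutive c (f s'))).card ≤ 4 := by
  let g := Function.invFunOn f S
  refine (Finset.card_le_card (t := {g (c + 1) + 1, g (c + 1) - 1, g (c - 1) + 1,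
    g (c - 1) - 1}) ?_).trans Finset.card_le_four
  intro t ht
  obtain ⟨_, s', hs', h₁, h₂⟩ := Finset.mem_filter.1 ht
  have hg : g (f s') = s' := hf.leftInvOn_invFunOn hs'
  have h₃ := h₁.eq_add_one_or_eq_sub_one
  rw [← hg] at h₃
  rcases h₂.symm.eq_add_one_or_eq_sub_one with h | h <;> rw [h] at h₃ <;>
    simp only [Finset.mem_insert, Finset.mem_singleton] <;> tauto

/-- If `s` is in conflict, the values at `s` and some other `t` can be exchanged so that neither
new position is forbidden or diagonally adjacent to a point of the graph of `f`. -/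
theorem exists_swap_candidate (hS : 18 ≤ S.card) (hf : Set.InjOn f S) (hs : s ∈ S)
    (hrow : (ζ.filter (fun p => p.1 = s)).card ≤ 4)
    (hcol : (ζ.filter (fun p => p.2 = f s)).card ≤ 4) (hbad : IsConflict S ζ f s) :
    ∃ t ∈ S, (s, f t) ∉ ζ ∧ (t, f s) ∉ ζ ∧ ¬ Consecutive s t ∧
      (∀ u ∈ S, Consecutive s u → ¬ Consecutive (f t) (f u)) ∧
      (∀ u ∈ S, Consecutive t u → ¬ Consecutive (f s) (f u)) := by
  classical
  set A := S.filter (fun t => (s, f t) ∈ ζ) with hA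
  set B := S.filter (fun t => (t, f s) ∈ ζ) with hB
  set C := S.filter (fun t => ∃ s' ∈ S, Consecutive s s' ∧ Consecutive (f t) (f s')) with hC
  set D := S.filter (fun t => ∃ s' ∈ S, Consecutive t s' ∧ Consecutive (f s) (f s')) with hD
  have cA : A.card ≤ 4 := card_filter_row_forbidden_le hf hrow
  have cB : B.card ≤ 4 := card_filter_col_forbidden_le hcol
  have cC : C.card ≤ 4 := card_filter_row_adjacent_le hf
  have cD : D.card ≤ 4 := card_filter_col_adjacent_le hf
  have cE : ({s + 1, s - 1} : Finset ℕ).card ≤ 2 := Finset.card_le_two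
  have hAB := Finset.card_union_add_card_inter A B
  have hCD := Finset.card_union_add_card_inter C D
  have hinter : 1 ≤ (A ∩ B).card + (C ∩ D).card := by
    rcases hbad with h | h
    · have : 0 < (A ∩ B).card := Finset.card_pos.2 ⟨s, by simp [hA, hB, hs, h]⟩
      omega
    · have : 0 < (C ∩ D).card := Finset.card_pos.2 ⟨s, by
        simp only [hC, hD, Finset.mem_inter, Finset.mem_filter]
        exact ⟨⟨hs, h⟩, hs, h⟩⟩
      omega
  have hlt : ((A ∪ B) ∪ (C ∪ D) ∪ {s + 1, s - 1}).card < S.card := by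
    have h₁ := Finset.card_union_le ((A ∪ B) ∪ (C ∪ D)) {s + 1, s - 1}
    have h₂ := Finset.card_union_le (A ∪ B) (C ∪ D)
    omega
  obtain ⟨t, ht, hnot⟩ := Finset.exists_mem_notMem_of_card_lt_card hlt
  simp only [Finset.mem_union, not_or, hA, hB, hC, hD, Finset.mem_filter, ht, true_and,
    Finset.mem_insert, Finset.mem_singleton, not_exists, not_and] at hnot
  obtain ⟨⟨⟨h₁, h₂⟩, h₃, h₄⟩, h₅, h₆⟩ := hnot
  exact ⟨t, ht, h₁, h₂, fun h => h.symm.eq_add_one_or_eq_sub_one.elim h₅ h₆, h₃, h₄⟩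

open Classical in
/-- A bijection with a conflict can be modified to have strictly fewer conflicts. -/
theorem exists_bijOn_card_conflict_lt (hS : 18 ≤ S.card) (hf : Set.BijOn f S T)
    (hrow : ∀ r ∈ S, (ζ.filter (fun p => p.1 = r)).card ≤ 4)
    (hcol : ∀ c ∈ T, (ζ.filter (fun p => p.2 = c)).card ≤ 4)
    (hs : s ∈ S) (hbad : IsConflict S ζ f s) :
    ∃ g : ℕ → ℕ, Set.BijOn g S T ∧
      (S.filter (IsConflict S ζ g)).card < (S.filter (IsConflict S ζ f)).card := by
  obtain ⟨t, ht, h₁, h₂, h₃, h₄, h₅⟩ :=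
    exists_swap_candidate hS hf.injOn hs (hrow s hs) (hcol _ (hf.mapsTo hs)) hbad
  let g := f ∘ Equiv.swap s t
  have gs : g s = f t := by simp [g]
  have gt : g t = f s := by simp [g]
  have gu : ∀ u, u ≠ s → u ≠ t → g u = f u := fun u hus hut => by
    simp [g, Equiv.swap_apply_of_ne_of_ne hus hut]
  have irrefl : ∀ a, ¬ Consecutive a a := fun a h => by unfold Consecutive at h; omega
  have ns : ∀ u ∈ S, Consecutive s u → ¬ Consecutive (g s) (g u) := by
    intro u hu hsu
    have hus : u ≠ s := by rintro rfl; exact irrefl _ hsu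
    have hut : u ≠ t := by rintro rfl; exact h₃ hsu
    rw [gs, gu u hus hut]
    exact h₄ u hu hsu
  have nt : ∀ u ∈ S, Consecutive t u → ¬ Consecutive (g t) (g u) := by
    intro u hu htu
    have hus : u ≠ s := by rintro rfl; exact h₃ htu.symm
    have hut : u ≠ t := by rintro rfl; exact irrefl _ htu
    rw [gt, gu u hus hut]
    exact h₅ u hu htu
  have hgs : ¬ IsConflict S ζ g s := by
    rintro (h | ⟨u, hu, hsu, h⟩)
    · exact h₁ (gs ▸ h)
    · exact ns u hu hsu h
  have hgt : ¬ IsConflict S ζ g t := by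
    rintro (h | ⟨u, hu, htu, h⟩)
    · exact h₂ (gt ▸ h)
    · exact nt u hu htu h
  refine ⟨g, hf.comp ?_, Finset.card_lt_card ((Finset.ssubset_iff_of_subset ?_).2
    ⟨s, Finset.mem_filter.2 ⟨hs, hbad⟩, fun h => hgs (Finset.mem_filter.1 h).2⟩)⟩
  · exact Equiv.swap_bijOn_self (iff_of_true hs ht)
  · intro u hu
    obtain ⟨huS, hu⟩ := Finset.mem_filter.1 hu
    have hus : u ≠ s := by rintro rfl; exact hgs hu
    have hut : u ≠ t := by rintro rfl; exact hgt hu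
    refine Finset.mem_filter.2 ⟨huS, ?_⟩
    rcases hu with h | ⟨v, hv, huv, h⟩
    · exact Or.inl (gu u hus hut ▸ h)
    · have hvs : v ≠ s := by rintro rfl; exact ns u huS huv.symm h.symm
      have hvt : v ≠ t := by rintro rfl; exact nt u huS huv.symm h.symm
      rw [gu u hus hut, gu v hvs hvt] at h
      exact Or.inr ⟨v, hv, huv, h⟩

open Classical in
theorem exists_bijOn_forall_not_isConflict (hS : 18 ≤ S.card) (hf : Set.BijOn f S T)
    (hrow : ∀ r ∈ S, (ζ.filter (fun p => p.1 = r)).card ≤ 4)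
    (hcol : ∀ c ∈ T, (ζ.filter (fun p => p.2 = c)).card ≤ 4) :
    ∃ g : ℕ → ℕ, Set.BijOn g S T ∧ ∀ s ∈ S, ¬ IsConflict S ζ g s := by
  induction hk : (S.filter (IsConflict S ζ f)).card using Nat.strong_induction_on
    generalizing f with
  | _ k ih =>
    by_cases h : ∃ s ∈ S, IsConflict S ζ f s
    · obtain ⟨s, hs, hbad⟩ := h
      obtain ⟨g, hg, hlt⟩ := exists_bijOn_card_conflict_lt hS hf hrow hcol hs hbad
      exact ih _ (hk ▸ hlt) hg rfl
    · push Not at h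
      exact ⟨f, hf, h⟩

end SwapCandidates


/-- Let `S, T ⊆ ℕ` be finite sets with `|S| = |T| = n` and `n ≥ 18`, and let
`ζ ⊆ S × T` contain at most 4 elements in each row and at most 4 elements in
each column. Then there is a bijection `f : S → T` avoiding `ζ` such that no
two distinct elements of its graph are diagonally adjacent. -/
theorem exists_bijection_avoiding_constraint_no_diagonal
    (n : ℕ) (hn : 18 ≤ n)
    (S T : Finset ℕ) (hS : S.card = n) (hT : T.card = n)
    (ζ : Finset (ℕ × ℕ)) (hζ : ζ ⊆ S ×ˢ T)
    (hrow : ∀ r ∈ S, (ζ.filter (fun p => p.1 = r)).card ≤ 4)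
    (hcol : ∀ c ∈ T, (ζ.filter (fun p => p.2 = c)).card ≤ 4) :
    ∃ f : ℕ → ℕ, Set.BijOn f ↑S ↑T ∧
      (∀ s ∈ S, (s, f s) ∉ ζ) ∧
      (∀ s ∈ S, ∀ s' ∈ S, s ≠ s' →
        ¬(|(s : ℤ) - (s' : ℤ)| = 1 ∧ |(f s : ℤ) - (f s' : ℤ)| = 1)) := by
  obtain ⟨f, hf⟩ := S.finite_toSet.exists_bijOn_of_encard_eq (t := (T : Set ℕ))
    (by simp [Set.encard_coe_eq_coe_finsetCard, hS, hT])
  obtain ⟨g, hg, hgood⟩ := exists_bijOn_forall_not_isConflict (hS ▸ hn) hf hrow hcol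
  exact ⟨g, hg, fun s hs h => hgood s hs (Or.inl h), fun s hs s' hs' _ h =>
    hgood s hs (Or.inr ⟨s', hs', consecutive_of_abs_sub_eq_one h.1,
      consecutive_of_abs_sub_eq_one h.2⟩)⟩
end

section
/- Let π₀ ⊆ ℕ × ℕ be a finite partial permutation (i.e., for every r ∈ ℕ there is at most one c with (r,c) ∈ π₀, and for every c ∈ ℕ there is at most one r with (r,c) ∈ π₀) such that no two distinct elements of π₀ are diagonally adjacent. Let S, T ⊆ ℕ be finite sets with |S| = |T| ≥ 18, such that no element of π₀ has its first coordinate in S and no element of π₀ has its second coordinate in T. Then there exists a bijection f : S → T such that in the set π₀ ∪ {(s, f(s)) : s ∈ S} no two distinct elements are diagonally adjacent. -/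
/-- Two pairs `(r,c), (r',c') ∈ ℕ × ℕ` are diagonally adjacent if
`|r − r'| = 1` and `|c − c'| = 1`. -/
def DiagAdj (p q : ℕ × ℕ) : Prop :=
  |(p.1 : ℤ) - (q.1 : ℤ)| = 1 ∧ |(p.2 : ℤ) - (q.2 : ℤ)| = 1

theorem DiagAdj.symm {p q : ℕ × ℕ} (h : DiagAdj p q) : DiagAdj q p := by
  unfold DiagAdj at *
  rwa [abs_sub_comm, abs_sub_comm (q.2 : ℤ)]

/-- If every row contains at most one point of `G`, then a fixed row `s` has at most four cells
diagonally adjacent to points of `G`. -/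
theorem card_diagAdj_row_le {G : Set (ℕ × ℕ)}
    (hG : ∀ r c c', (r, c) ∈ G → (r, c') ∈ G → c = c') (s : ℕ) (A : Finset ℕ)
    (hA : ∀ t ∈ A, ∃ q ∈ G, DiagAdj (s, t) q) : A.card ≤ 4 := by
  obtain ⟨g, hg⟩ : ∃ g : ℕ → ℕ, ∀ r c, (r, c) ∈ G → g r = c := by
    have h (r : ℕ) : ∃ b, ∀ c, (r, c) ∈ G → b = c := by
      by_cases h : ∃ c, (r, c) ∈ G
      · obtain ⟨b, hb⟩ := h
        exact ⟨b, fun c hc => hG r b c hb hc⟩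
      · exact ⟨0, fun c hc => (h ⟨c, hc⟩).elim⟩
    choose g hg using h
    exact ⟨g, hg⟩
  have hsub : A ⊆ {g (s - 1) - 1, g (s - 1) + 1, g (s + 1) - 1, g (s + 1) + 1} := by
    intro t ht
    obtain ⟨⟨r, c⟩, hq, h1, h2⟩ := hA t ht
    have hc := hg r c hq
    simp only [Finset.mem_insert, Finset.mem_singleton]
    rw [abs_eq zero_le_one] at h1 h2
    dsimp only at h1 h2
    have hr : r = s - 1 ∨ r = s + 1 := by omega
    rcases hr with rfl | rfl <;> omega
  exact (Finset.card_le_card hsub).trans Finset.card_le_four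

/-- If every column contains at most one point of `G`, then a fixed column `t` has at most four
cells diagonally adjacent to points of `G`. -/
theorem card_diagAdj_col_le {G : Set (ℕ × ℕ)}
    (hG : ∀ r r' c, (r, c) ∈ G → (r', c) ∈ G → r = r') (t : ℕ) (A : Finset ℕ)
    (hA : ∀ s ∈ A, ∃ q ∈ G, DiagAdj (s, t) q) : A.card ≤ 4 :=
  card_diagAdj_row_le (G := Prod.swap ⁻¹' G) (fun c r r' => hG r r' c) t A fun s hs =>
    let ⟨q, hq, h⟩ := hA s hs
    ⟨q.swap, by simpa using hq, h.2, h.1⟩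

/-- The union of `P` and the graph of `f` on `S`. -/
def unionGraph (P : Finset (ℕ × ℕ)) (S : Finset ℕ) (f : ℕ → ℕ) : Set (ℕ × ℕ) :=
  ↑P ∪ {q : ℕ × ℕ | ∃ s ∈ S, q = (s, f s)}

open Classical in
/-- The rows of `S` whose point on the graph of `f` is diagonally adjacent to a point of
`unionGraph P S f`. -/
noncomputable def conflictRows (P : Finset (ℕ × ℕ)) (S : Finset ℕ) (f : ℕ → ℕ) : Finset ℕ :=
  S.filter fun s => ∃ q ∈ unionGraph P S f, DiagAdj (s, f s) q

section Switching

variable {P : Finset (ℕ × ℕ)} {S T : Finset ℕ} {f : ℕ → ℕ}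

theorem mem_conflictRows {s : ℕ} :
    s ∈ conflictRows P S f ↔ s ∈ S ∧ ∃ q ∈ unionGraph P S f, DiagAdj (s, f s) q := by
  simp [conflictRows]

theorem unionGraph_row_unique (hfun : ∀ r c c', (r, c) ∈ P → (r, c') ∈ P → c = c')
    (hS : ∀ p ∈ P, p.1 ∉ S) (r c c' : ℕ) (h : (r, c) ∈ unionGraph P S f)
    (h' : (r, c') ∈ unionGraph P S f) : c = c' := by
  rcases h with h | ⟨s, hs, h⟩ <;> rcases h' with h' | ⟨s', hs', h'⟩
  · exact hfun r c c' h h'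
  · obtain ⟨rfl, rfl⟩ := Prod.mk.inj h'
    exact (hS _ h hs').elim
  · obtain ⟨rfl, rfl⟩ := Prod.mk.inj h
    exact (hS _ h' hs).elim
  · grind

theorem unionGraph_col_unique (hinj : ∀ r r' c, (r, c) ∈ P → (r', c) ∈ P → r = r')
    (hT : ∀ p ∈ P, p.2 ∉ T) (hf : Set.BijOn f S T) (r r' c : ℕ)
    (h : (r, c) ∈ unionGraph P S f) (h' : (r', c) ∈ unionGraph P S f) : r = r' := by
  rcases h with h | ⟨s, hs, h⟩ <;> rcases h' with h' | ⟨s', hs', h'⟩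
  · exact hinj r r' c h h'
  · obtain ⟨rfl, rfl⟩ := Prod.mk.inj h'
    exact (hT _ h (hf.mapsTo hs')).elim
  · obtain ⟨rfl, rfl⟩ := Prod.mk.inj h
    exact (hT _ h' (hf.mapsTo hs)).elim
  · obtain ⟨rfl, rfl⟩ := Prod.mk.inj h
    obtain ⟨rfl, heq⟩ := Prod.mk.inj h'
    exact hf.injOn hs hs' heq

/-- A partner row `s'` such that exchanging `f s` and `f s'` creates no diagonal adjacency. -/
theorem exists_switch_partner (hfun : ∀ r c c', (r, c) ∈ P → (r, c') ∈ P → c = c')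
    (hinj : ∀ r r' c, (r, c) ∈ P → (r', c) ∈ P → r = r')
    (hcard : 11 ≤ S.card) (hS : ∀ p ∈ P, p.1 ∉ S) (hT : ∀ p ∈ P, p.2 ∉ T)
    (hf : Set.BijOn f S T) (s : ℕ) :
    ∃ s' ∈ S, ¬ |(s : ℤ) - s'| = 1 ∧
      (∀ q ∈ unionGraph P S f, ¬ DiagAdj (s, f s') q) ∧
      ∀ q ∈ unionGraph P S f, ¬ DiagAdj (s', f s) q := by
  classical
  let A := S.filter fun x => ∃ q ∈ unionGraph P S f, DiagAdj (s, f x) q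
  let B := S.filter fun x => ∃ q ∈ unionGraph P S f, DiagAdj (x, f s) q
  have hA : A.card ≤ 4 := by
    rw [← Finset.card_image_of_injOn
      (hf.injOn.mono (Finset.coe_subset.2 (Finset.filter_subset _ S)) : Set.InjOn f A)]
    refine card_diagAdj_row_le (unionGraph_row_unique (f := f) hfun hS) s _ fun t ht => ?_
    obtain ⟨x, hx, rfl⟩ := Finset.mem_image.1 ht
    exact (Finset.mem_filter.1 hx).2
  have hB : B.card ≤ 4 :=
    card_diagAdj_col_le (unionGraph_col_unique hinj hT hf) (f s) B fun x hx =>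
      (Finset.mem_filter.1 hx).2
  have hlt : (A ∪ B ∪ {s - 1, s + 1}).card < S.card := by
    have h1 := Finset.card_union_le (A ∪ B) {s - 1, s + 1}
    have h2 := Finset.card_union_le A B
    have h3 := Finset.card_le_two (a := s - 1) (b := s + 1)
    omega
  obtain ⟨s', hs', hn⟩ := Finset.exists_mem_notMem_of_card_lt_card hlt
  simp only [Finset.mem_union, Finset.mem_insert, Finset.mem_singleton, not_or, A, B,
    Finset.mem_filter, not_and, not_exists] at hn
  obtain ⟨⟨h1, h2⟩, h3, h4⟩ := hn
  exact ⟨s', hs', by rw [abs_eq zero_le_one]; omega, h1 hs', h2 hs'⟩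

theorem exists_bijOn_conflictRows_card_lt
    (hfun : ∀ r c c', (r, c) ∈ P → (r, c') ∈ P → c = c')
    (hinj : ∀ r r' c, (r, c) ∈ P → (r', c) ∈ P → r = r')
    (hcard : 11 ≤ S.card) (hS : ∀ p ∈ P, p.1 ∉ S) (hT : ∀ p ∈ P, p.2 ∉ T)
    (hf : Set.BijOn f S T) {s : ℕ} (hs : s ∈ conflictRows P S f) :
    ∃ f' : ℕ → ℕ, Set.BijOn f' S T ∧ (conflictRows P S f').card < (conflictRows P S f).card := by
  obtain ⟨s', hs', hadj, h1, h2⟩ := exists_switch_partner hfun hinj hcard hS hT hf s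
  have hsS : s ∈ S := (mem_conflictRows.1 hs).1
  let f' : ℕ → ℕ := f ∘ Equiv.swap s s'
  have mem_cases : ∀ p ∈ unionGraph P S f',
      (p ∈ unionGraph P S f ∧ p.1 ≠ s ∧ p.1 ≠ s') ∨ p = (s, f s') ∨ p = (s', f s) := by
    rintro p (hp | ⟨x, hx, rfl⟩)
    · exact .inl ⟨.inl hp, fun h => hS p hp (h ▸ hsS), fun h => hS p hp (h ▸ hs')⟩
    · by_cases hxs : x = s
      · simp [f', hxs]
      by_cases hxs' : x = s'
      · simp [f', hxs']
      · have hx' : f' x = f x := congrArg f (Equiv.swap_apply_of_ne_of_ne hxs hxs')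
        exact .inl ⟨.inr ⟨x, hx, by rw [hx']⟩, hxs, hxs'⟩
  have adj_old : ∀ p ∈ unionGraph P S f', ∀ q ∈ unionGraph P S f', DiagAdj p q →
      (p ∈ unionGraph P S f ∧ p.1 ≠ s ∧ p.1 ≠ s') ∧ q ∈ unionGraph P S f := by
    intro p hp q hq h
    rcases mem_cases p hp with hp | rfl | rfl <;> rcases mem_cases q hq with hq | rfl | rfl
    · exact ⟨hp, hq.1⟩
    · exact (h1 p hp.1 h.symm).elim
    · exact (h2 p hp.1 h.symm).elim
    · exact (h1 q hq.1 h).elim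
    · simp [DiagAdj] at h
    · exact (hadj h.1).elim
    · exact (h2 q hq.1 h).elim
    · exact (hadj h.symm.1).elim
    · simp [DiagAdj] at h
  refine ⟨f', hf.comp ?_, Finset.card_lt_card ((Finset.ssubset_iff_of_subset ?_).2 ⟨s, hs, ?_⟩)⟩
  · refine ⟨fun x hx => ?_, (Equiv.injective _).injOn, fun x hx => ⟨Equiv.swap s s' x, ?_, by simp⟩⟩
    all_goals
      rw [Equiv.swap_apply_def]
      split_ifs <;> assumption
  · intro x hx
    obtain ⟨hxS, q, hq, h⟩ := mem_conflictRows.1 hx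
    obtain ⟨⟨-, hxs, hxs'⟩, hq'⟩ := adj_old _ (.inr ⟨x, hxS, rfl⟩) q hq h
    have hx' : f' x = f x := congrArg f (Equiv.swap_apply_of_ne_of_ne hxs hxs')
    exact mem_conflictRows.2 ⟨hxS, q, hq', hx' ▸ h⟩
  · intro hx
    obtain ⟨-, q, hq, h⟩ := mem_conflictRows.1 hx
    exact (adj_old _ (.inr ⟨s, hsS, rfl⟩) q hq h).1.2.1 rfl

theorem exists_bijOn_conflictRows_eq_empty
    (hfun : ∀ r c c', (r, c) ∈ P → (r, c') ∈ P → c = c')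
    (hinj : ∀ r r' c, (r, c) ∈ P → (r', c) ∈ P → r = r')
    (hcard : 11 ≤ S.card) (hS : ∀ p ∈ P, p.1 ∉ S) (hT : ∀ p ∈ P, p.2 ∉ T)
    (hf : Set.BijOn f S T) : ∃ f' : ℕ → ℕ, Set.BijOn f' S T ∧ conflictRows P S f' = ∅ := by
  induction hn : (conflictRows P S f).card using Nat.strong_induction_on generalizing f with
  | _ n ih =>
    rcases (conflictRows P S f).eq_empty_or_nonempty with h | ⟨s, hs⟩
    · exact ⟨f, hf, h⟩
    · obtain ⟨f', hf', hlt⟩ := exists_bijOn_conflictRows_card_lt hfun hinj hcard hS hT hf hs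
      exact ih _ (hn ▸ hlt) hf' rfl

end Switching

/-- Let `π₀ ⊆ ℕ × ℕ` be a finite partial permutation with no two distinct
elements diagonally adjacent. Let `S, T ⊆ ℕ` be finite sets with
`|S| = |T| ≥ 18`, such that no element of `π₀` has its first coordinate in `S`
and no element of `π₀` has its second coordinate in `T`. Then there is a
bijection `f : S → T` such that in `π₀ ∪ {(s, f s) : s ∈ S}` no two distinct
elements are diagonally adjacent. -/
theorem exists_bijection_extending_no_diagonal
    (π₀ : Finset (ℕ × ℕ))
    (hfun : ∀ r c c', (r, c) ∈ π₀ → (r, c') ∈ π₀ → c = c')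
    (hinj : ∀ r r' c, (r, c) ∈ π₀ → (r', c) ∈ π₀ → r = r')
    (hdiag : ∀ p ∈ π₀, ∀ q ∈ π₀, p ≠ q → ¬ DiagAdj p q)
    (S T : Finset ℕ) (hcard : S.card = T.card) (h18 : 18 ≤ S.card)
    (hS : ∀ p ∈ π₀, p.1 ∉ S) (hT : ∀ p ∈ π₀, p.2 ∉ T) :
    ∃ f : ℕ → ℕ, Set.BijOn f ↑S ↑T ∧
      ∀ p ∈ (↑π₀ ∪ {q : ℕ × ℕ | ∃ s ∈ S, q = (s, f s)} : Set (ℕ × ℕ)),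
        ∀ q ∈ (↑π₀ ∪ {q : ℕ × ℕ | ∃ s ∈ S, q = (s, f s)} : Set (ℕ × ℕ)),
          p ≠ q → ¬ DiagAdj p q := by
  obtain ⟨f₀, hf₀⟩ : ∃ f : ℕ → ℕ, Set.BijOn f ↑S ↑T :=
    S.finite_toSet.exists_bijOn_of_encard_eq (by simp [hcard])
  obtain ⟨f, hf, hempty⟩ :=
    exists_bijOn_conflictRows_eq_empty hfun hinj (by omega) hS hT hf₀
  have hrow : ∀ s ∈ S, ∀ q ∈ unionGraph π₀ S f, ¬ DiagAdj (s, f s) q := fun s hs q hq h =>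
    Finset.notMem_empty s (hempty ▸ mem_conflictRows.2 ⟨hs, q, hq, h⟩)
  refine ⟨f, hf, fun p hp q hq hpq h => ?_⟩
  rcases hp with hp | ⟨s, hs, rfl⟩
  · rcases hq with hq | ⟨s, hs, rfl⟩
    · exact hdiag p hp q hq hpq h
    · exact hrow s hs p (.inl hp) h.symm
  · exact hrow s hs q hq h
end

section
/- Let n ∈ ℕ, let π : [n] → [n] be a bijection, and let λ : [n] → A ∪ {□} be a labeling of the permutation elements (r, π(r)), where A is a finite alphabet not containing the special symbol □. Suppose there is no zone Z = [i, i+l] × [j, j+l] such that Z contains at least two elements of the graph of π and every element of the graph of π contained in Z is labeled □ (that is, every zone all of whose contained permutation elements are labeled □ contains at most one permutation element). Then the number of indices r ∈ [n] with λ(r) = □ is at most (1 + m)², where m is the number of indices r ∈ [n] with λ(r) ≠ □. -/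
/-- The elements of `[1, n] \ L` with exactly `k` elements of `L` below them. -/
def gap (L : Finset ℕ) (n k : ℕ) : Finset ℕ :=
  (Finset.Icc 1 n).filter fun r => r ∉ L ∧ (L.filter (· < r)).card = k

theorem mem_gap {L : Finset ℕ} {n k r : ℕ} :
    r ∈ gap L n k ↔ r ∈ Finset.Icc 1 n ∧ r ∉ L ∧ (L.filter (· < r)).card = k := by
  simp [gap]

theorem gap_ordConnected {L : Finset ℕ} {n k r s x : ℕ} (hr : r ∈ gap L n k)
    (hs : s ∈ gap L n k) (hrx : r ≤ x) (hxs : x ≤ s) : x ∈ gap L n k := by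
  rw [mem_gap] at *
  obtain ⟨hr1, hr2, hr3⟩ := hr
  obtain ⟨hs1, hs2, hs3⟩ := hs
  rw [Finset.mem_Icc] at *
  have hsub : L.filter (· < r) ⊆ L.filter (· < x) := by
    intro y; simp only [Finset.mem_filter]; grind
  have hsub' : L.filter (· < x) ⊆ L.filter (· < s) := by
    intro y; simp only [Finset.mem_filter]; grind
  have h1 := Finset.card_le_card hsub
  have h2 := Finset.card_le_card hsub'
  refine ⟨by omega, fun hxL => ?_, by omega⟩
  have heq := Finset.eq_of_subset_of_card_le (hsub.trans hsub') (by omega)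
  have hx : x ∈ L.filter (· < s) := by
    simp only [Finset.mem_filter]; grind
  rw [← heq, Finset.mem_filter] at hx
  omega

theorem exists_gap_eq_Icc {L : Finset ℕ} {n k : ℕ} (h : (gap L n k).Nonempty) :
    ∃ i l, gap L n k = Finset.Icc i (i + l) ∧ (gap L n k).card = l + 1 := by
  have hI : gap L n k = Finset.Icc ((gap L n k).min' h) ((gap L n k).max' h) := by
    ext x
    rw [Finset.mem_Icc]
    exact ⟨fun hx => ⟨Finset.min'_le _ _ hx, Finset.le_max' _ _ hx⟩,
      fun hx => gap_ordConnected (Finset.min'_mem _ h) (Finset.max'_mem _ h) hx.1 hx.2⟩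
  have hle := Finset.min'_le_max' _ h
  refine ⟨(gap L n k).min' h, (gap L n k).max' h - (gap L n k).min' h, ?_, ?_⟩
  · rwa [Nat.add_sub_cancel' hle]
  · rw [congrArg Finset.card hI, Nat.card_Icc]
    omega

theorem sum_card_gap {L : Finset ℕ} {n : ℕ} :
    ∑ k ∈ Finset.range (L.card + 1), (gap L n k).card = ((Finset.Icc 1 n).filter (· ∉ L)).card := by
  refine ((Finset.card_eq_sum_card_fiberwise (f := fun r => (L.filter (· < r)).card)
    (t := Finset.range (L.card + 1)) ?_).trans (Finset.sum_congr rfl fun k _ => ?_)).symm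
  · intro r _
    simpa [Nat.lt_succ_iff] using Finset.card_filter_le L (· < r)
  · rw [Finset.filter_filter]
    rfl

/-- A nonempty `d`-separated set of numbers at most `n` has an element at most
`n - d * (card - 1)`. -/
theorem exists_add_mul_le_of_separated {ι : Type*} {S : Finset ι} {f : ι → ℕ} {n d : ℕ}
    (hd : 0 < d) (hS : S.Nonempty) (hn : ∀ x ∈ S, f x ≤ n)
    (hsep : ∀ x ∈ S, ∀ y ∈ S, x ≠ y → f x ≤ f y → f x + d ≤ f y) :
    ∃ x ∈ S, f x + d * (S.card - 1) ≤ n := by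
  obtain ⟨a, ha, hmin⟩ := Finset.exists_min_image S f hS
  refine ⟨a, ha, ?_⟩
  have hcard : S.card ≤ (Finset.range ((n - f a) / d + 1)).card := by
    refine Finset.card_le_card_of_injOn (fun x => (f x - f a) / d) ?_ ?_
    · intro x hx
      have := Nat.div_le_div_right (c := d) (Nat.sub_le_sub_right (hn x hx) (f a))
      simp only [Finset.coe_range, Set.mem_Iio]
      omega
    · have key : ∀ x ∈ S, ∀ y ∈ S, x ≠ y → f x ≤ f y → (f x - f a) / d < (f y - f a) / d := by
        intro x hx y hy hxy hle
        have h1 := hsep x hx y hy hxy hle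
        have h2 := hmin x hx
        have h3 : f x - f a + d ≤ f y - f a := by omega
        have h4 := Nat.div_le_div_right (c := d) h3
        rw [Nat.add_div_right _ hd] at h4
        exact h4
      intro x hx y hy hxy
      by_contra hne
      rcases le_total (f x) (f y) with h | h
      · exact (key x hx y hy hne h).ne hxy
      · exact (key y hy x hx (Ne.symm hne) h).ne hxy.symm
  rw [Finset.card_range] at hcard
  have h1 : d * (S.card - 1) ≤ d * ((n - f a) / d) :=
    Nat.mul_le_mul_left d (Nat.sub_le_iff_le_add.2 hcard)
  have h2 := Nat.mul_div_le (n - f a) d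
  have h3 := hn a ha
  omega

/-- A numerical form of the pigeonhole argument: the summands `g k` cannot be too large on average
if each summand `p` forces `p * (p - 1) < n` and few of them attain the same value `p`. -/
theorem sum_le_sq_of_card_le {m n N : ℕ} (g : ℕ → ℕ)
    (hsum : ∑ k ∈ Finset.range (m + 1), g k = N) (hn : N + m = n)
    (hlt : ∀ k, 0 < g k → g k * (g k - 1) < n)
    (hcount : ∀ p, 0 < p →
      ((Finset.range (m + 1)).filter (fun k => g k = p)).card ≤ n - p * (p - 1)) :
    N ≤ (1 + m) ^ 2 := by
  by_contra! hN
  obtain ⟨b, hb, hmax⟩ := Finset.exists_max_image (Finset.range (m + 1)) g ⟨0, by simp⟩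
  have hle : N ≤ (m + 1) * g b := by
    rw [← hsum]
    simpa using Finset.sum_le_card_nsmul _ _ _ hmax
  have hgb : m + 2 ≤ g b := by
    by_contra! h
    nlinarith
  obtain ⟨q, hq⟩ : ∃ q, g b = m + 2 + q := ⟨g b - (m + 2), by omega⟩
  have hb' := hlt b (by omega)
  have hq0 : q = 0 := by
    rw [hq] at hb' hle
    rw [show m + 2 + q - 1 = m + 1 + q by omega] at hb'
    by_contra h
    have : 1 ≤ q := by omega
    nlinarith
  subst hq0
  have hT : N ≤ (m + 1) * (m + 1) +
      ((Finset.range (m + 1)).filter (fun k => g k = m + 2)).card := by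
    rw [← hsum, Finset.card_filter]
    calc ∑ k ∈ Finset.range (m + 1), g k
        ≤ ∑ k ∈ Finset.range (m + 1), ((m + 1) + if g k = m + 2 then 1 else 0) := by
          refine Finset.sum_le_sum fun k hk => ?_
          have := hmax k hk
          split_ifs <;> omega
      _ = _ := by simp [Finset.sum_add_distrib]
  have hc := hcount (m + 2) (by omega)
  rw [hq] at hb'
  simp only [show m + 2 + 0 - 1 = m + 1 by omega] at hb' hc
  have h1 : (m + 2) * (m + 1) = (m + 1) * (m + 1) + (m + 1) := by ring
  simp only [Nat.add_zero] at hb'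
  omega

/-- Let `π : [n] → [n]` be a bijection (with `[n] = {1,…,n}`) and let
`lab : [n] → A ∪ {□}` be a labeling of the permutation elements `(r, π r)`,
where the special symbol `□` is represented by `none : Option A`.
A *zone* is a square `[i, i+l] × [j, j+l] ⊆ [n] × [n]`.
Suppose no zone contains at least two elements of the graph of `π` all of
which are labeled `□` (i.e., every zone all of whose contained permutation
elements are labeled `□` contains at most one permutation element).
Then the number of `r ∈ [n]` with `lab r = □` is at most `(1 + m)²`, where
`m` is the number of `r ∈ [n]` with `lab r ≠ □`. -/
theorem card_box_labels_le
    (A : Type) [Fintype A] [DecidableEq A] (n : ℕ)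
    (π : ℕ → ℕ) (hπ : Set.BijOn π (Set.Icc 1 n) (Set.Icc 1 n))
    (lab : ℕ → Option A)
    (hzone : ∀ i j l : ℕ, 1 ≤ i → 1 ≤ j → i + l ≤ n → j + l ≤ n →
      (∀ r ∈ Finset.Icc 1 n,
        (r ∈ Finset.Icc i (i + l) ∧ π r ∈ Finset.Icc j (j + l)) → lab r = none) →
      ((Finset.Icc 1 n).filter
        (fun r => r ∈ Finset.Icc i (i + l) ∧ π r ∈ Finset.Icc j (j + l))).card ≤ 1) :
    ((Finset.Icc 1 n).filter (fun r => lab r = none)).card ≤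
      (1 + ((Finset.Icc 1 n).filter (fun r => lab r ≠ none)).card) ^ 2 := by
  have hmem : ∀ r ∈ Finset.Icc 1 n, π r ∈ Finset.Icc 1 n := fun r hr => by
    simpa using hπ.mapsTo (by simpa using hr)
  set L := (Finset.Icc 1 n).filter (fun r => lab r ≠ none) with hL
  have hnone : (Finset.Icc 1 n).filter (fun r => lab r = none) =
      (Finset.Icc 1 n).filter (· ∉ L) := by
    refine Finset.filter_congr fun r hr => ?_
    simp [hL, -Finset.mem_Icc, hr]
  have hsep : ∀ k, ∀ r ∈ gap L n k, ∀ s ∈ gap L n k, r ≠ s → π r ≤ π s →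
      π r + (gap L n k).card ≤ π s := by
    intro k r hr s hs hrs hle
    obtain ⟨i, l, hI, hc⟩ := exists_gap_eq_Icc ⟨r, hr⟩
    have hin : ∀ x, i ≤ x → x ≤ i + l → x ∈ gap L n k := fun x h1 h2 => by
      rw [hI, Finset.mem_Icc]; exact ⟨h1, h2⟩
    have h1 := Finset.mem_Icc.1 (mem_gap.1 (hin i le_rfl (by omega))).1
    have h2 := Finset.mem_Icc.1 (mem_gap.1 (hin (i + l) (by omega) le_rfl)).1
    have hr1 := (mem_gap.1 hr).1
    have hs1 := (mem_gap.1 hs).1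
    have hr2 := Finset.mem_Icc.1 (hmem r hr1)
    have hs2 := Finset.mem_Icc.1 (hmem s hs1)
    by_contra! hlt
    rw [hc] at hlt
    have hz := hzone i (min (π r) (n - l)) l (by omega) (by omega) (by omega) (by omega) ?_
    · rw [Finset.card_le_one] at hz
      refine hrs (hz r ?_ s ?_)
      · rw [Finset.mem_filter, ← hI, Finset.mem_Icc (a := min _ _)]
        exact ⟨hr1, hr, by omega, by omega⟩
      · rw [Finset.mem_filter, ← hI, Finset.mem_Icc (a := min _ _)]
        exact ⟨hs1, hs, by omega, by omega⟩
    · rintro x hx ⟨hxI, -⟩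
      rw [← hI] at hxI
      have hxL := (mem_gap.1 hxI).2.1
      simpa [hL, -Finset.mem_Icc, hx] using hxL
  have hlow : ∀ k, 0 < (gap L n k).card → ∃ r ∈ gap L n k,
      π r + (gap L n k).card * ((gap L n k).card - 1) ≤ n := fun k hk =>
    exists_add_mul_le_of_separated hk (Finset.card_pos.1 hk)
      (fun r hr => (Finset.mem_Icc.1 (hmem r (mem_gap.1 hr).1)).2) (hsep k)
  rw [hnone]
  refine sum_le_sq_of_card_le (n := n) (fun k => (gap L n k).card) sum_card_gap ?_ ?_ ?_
  · rw [← hnone, hL, Finset.card_filter_add_card_filter_not]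
    simp
  · intro k hk
    obtain ⟨r, hr, hle⟩ := hlow k hk
    have := Finset.mem_Icc.1 (hmem r (mem_gap.1 hr).1)
    omega
  · intro p hp
    have hex : ∀ k, ∃ r, (gap L n k).card = p → r ∈ gap L n k ∧ π r + p * (p - 1) ≤ n := by
      intro k
      by_cases hk : (gap L n k).card = p
      · obtain ⟨r, hr, hle⟩ := hlow k (by omega)
        exact ⟨r, fun _ => ⟨hr, hk ▸ hle⟩⟩
      · exact ⟨0, fun h => absurd h hk⟩
    choose e he using hex
    rw [← Nat.add_sub_cancel (n := n - p * (p - 1)) (m := 1), ← Nat.card_Icc]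
    refine Finset.card_le_card_of_injOn (fun k => π (e k)) ?_ ?_
    · intro k hk
      obtain ⟨h1, h2⟩ := he k (Finset.mem_filter.1 hk).2
      have := Finset.mem_Icc.1 (hmem _ (mem_gap.1 h1).1)
      rw [Finset.mem_coe, Finset.mem_Icc]
      dsimp only
      omega
    · intro k hk k' hk' heq
      have h1 := mem_gap.1 (he k (Finset.mem_filter.1 hk).2).1
      have h2 := mem_gap.1 (he k' (Finset.mem_filter.1 hk').2).1
      have hee := hπ.injOn (by simpa using h1.1) (by simpa using h2.1) heq
      rw [← h1.2.2, hee, h2.2.2]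
end

section
/- Let A be a finite alphabet and let w₁, w₂ ∈ Aᵐ be two words of the same length m with equal Parikh images, i.e., for every a ∈ A the number of positions i with w₁[i] = a equals the number of positions i with w₂[i] = a. Suppose furthermore that every letter that occurs in w₁ occurs at least 18 times in w₁. Then there exists a bijection σ : [m] → [m] such that w₁[i] = w₂[σ(i)] for every i ∈ [m], and there are no two positions i, j ∈ [m] with |i − j| = 1 and |σ(i) − σ(j)| = 1. -/
namespace MatchingPermutation

/-- Positions at distance one from `x`. -/
def neighbors {m : ℕ} (x : Fin m) : Finset (Fin m) :=
  Finset.univ.filter fun y => |(x : ℤ) - (y : ℤ)| = 1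

/-- Ordered pairs of adjacent positions that `σ` maps to adjacent positions. -/
def conflicts {m : ℕ} (σ : Equiv.Perm (Fin m)) : Finset (Fin m × Fin m) :=
  Finset.univ.filter fun p => p.2 ∈ neighbors p.1 ∧ σ p.2 ∈ neighbors (σ p.1)

variable {m : ℕ}

theorem mem_neighbors {x y : Fin m} : y ∈ neighbors x ↔ |(x : ℤ) - (y : ℤ)| = 1 := by
  simp [neighbors]

theorem mem_neighbors_comm {x y : Fin m} : y ∈ neighbors x ↔ x ∈ neighbors y := by
  rw [mem_neighbors, mem_neighbors, abs_sub_comm]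

theorem notMem_neighbors_self (x : Fin m) : x ∉ neighbors x := by
  simp [mem_neighbors]

theorem mem_conflicts {σ : Equiv.Perm (Fin m)} {x y : Fin m} :
    (x, y) ∈ conflicts σ ↔ y ∈ neighbors x ∧ σ y ∈ neighbors (σ x) := by
  simp [conflicts]

theorem card_neighbors_le (x : Fin m) : (neighbors x).card ≤ 2 := by
  calc (neighbors x).card
      = ((neighbors x).image fun y : Fin m => (y : ℤ)).card := by
        rw [Finset.card_image_of_injective]
        intro a b h
        exact Fin.ext (by simpa using h)
    _ ≤ ({(x : ℤ) - 1, (x : ℤ) + 1} : Finset ℤ).card := by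
        refine Finset.card_le_card fun z hz => ?_
        obtain ⟨y, hy, rfl⟩ := Finset.mem_image.1 hz
        rw [mem_neighbors, abs_eq one_pos.le] at hy
        simp only [Finset.mem_insert, Finset.mem_singleton]
        omega
    _ ≤ 2 := Finset.card_le_two

theorem exists_equiv_of_card_fiber_eq {α A : Type*} [Fintype α] [DecidableEq A] (f g : α → A)
    (h : ∀ a : A, (Finset.univ.filter (fun i => f i = a)).card =
      (Finset.univ.filter (fun i => g i = a)).card) :
    ∃ σ : Equiv.Perm α, ∀ i, f i = g (σ i) := by
  have e : ∀ a, Nonempty ({i // f i = a} ≃ {i // g i = a}) := fun a =>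
    Fintype.card_eq.1 (by rw [Fintype.card_subtype, Fintype.card_subtype, h a])
  exact ⟨Equiv.ofFiberEquiv fun a => (e a).some, fun i => (Equiv.ofFiberEquiv_map _ i).symm⟩

/-- Any set of at least twelve positions contains one that can be exchanged with `i` without
leaving a conflict at either exchanged position. -/
theorem exists_safe_swap (σ : Equiv.Perm (Fin m)) (i : Fin m) (S : Finset (Fin m))
    (hS : 12 ≤ S.card) :
    ∃ k ∈ S, k ≠ i ∧ k ∉ neighbors i ∧ (∀ y ∈ neighbors i, σ k ∉ neighbors (σ y)) ∧
      ∀ y ∈ neighbors k, σ y ∉ neighbors (σ i) := by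
  set P := (neighbors i).biUnion fun y => (neighbors (σ y)).image σ.symm
  set Q := ((neighbors (σ i)).image σ.symm).biUnion neighbors
  have cP : P.card ≤ 4 := by
    have : P.card ≤ _ := Finset.card_biUnion_le_card_mul (neighbors i)
      (fun y => (neighbors (σ y)).image σ.symm) 2
      fun y _ => Finset.card_image_le.trans (card_neighbors_le _)
    have := card_neighbors_le i
    omega
  have cQ : Q.card ≤ 4 := by
    have : Q.card ≤ _ := Finset.card_biUnion_le_card_mul ((neighbors (σ i)).image σ.symm) neighbors 2
      fun y _ => card_neighbors_le y
    have := (Finset.card_image_le (s := neighbors (σ i)) (f := σ.symm)).trans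
      (card_neighbors_le _)
    omega
  have cB : (insert i (neighbors i ∪ (P ∪ Q))).card < S.card := by
    have := Finset.card_insert_le i (neighbors i ∪ (P ∪ Q))
    have := Finset.card_union_le (neighbors i) (P ∪ Q)
    have := Finset.card_union_le P Q
    have := card_neighbors_le i
    omega
  obtain ⟨k, hkS, hk⟩ := Finset.exists_mem_notMem_of_card_lt_card cB
  simp only [Finset.mem_insert, Finset.mem_union, not_or] at hk
  obtain ⟨h1, h2, h3, h4⟩ := hk
  refine ⟨k, hkS, h1, h2, fun y hy hk => h3 ?_, fun y hy hk => h4 ?_⟩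
  · exact Finset.mem_biUnion.2 ⟨y, hy, Finset.mem_image.2 ⟨σ k, hk, by simp⟩⟩
  · exact Finset.mem_biUnion.2
      ⟨y, Finset.mem_image.2 ⟨σ y, hk, by simp⟩, mem_neighbors_comm.1 hy⟩

theorem conflicts_mul_swap_ssubset {σ : Equiv.Perm (Fin m)} {i j k : Fin m}
    (hij : (i, j) ∈ conflicts σ) (hki : k ≠ i) (hk : k ∉ neighbors i)
    (h1 : ∀ y ∈ neighbors i, σ k ∉ neighbors (σ y))
    (h2 : ∀ y ∈ neighbors k, σ y ∉ neighbors (σ i)) :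
    conflicts (σ * Equiv.swap i k) ⊂ conflicts σ := by
  have hi : ∀ y, (i, y) ∉ conflicts (σ * Equiv.swap i k) := by
    intro y hy
    obtain ⟨a, b⟩ := mem_conflicts.1 hy
    have hyi : y ≠ i := fun h => notMem_neighbors_self i (h ▸ a)
    have hyk : y ≠ k := fun h => hk (h ▸ a)
    rw [Equiv.Perm.mul_apply, Equiv.Perm.mul_apply, Equiv.swap_apply_left,
      Equiv.swap_apply_of_ne_of_ne hyi hyk] at b
    exact h1 y a (mem_neighbors_comm.1 b)
  have hk' : ∀ y, (k, y) ∉ conflicts (σ * Equiv.swap i k) := by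
    intro y hy
    obtain ⟨a, b⟩ := mem_conflicts.1 hy
    have hyk : y ≠ k := fun h => notMem_neighbors_self k (h ▸ a)
    have hyi : y ≠ i := fun h => hk (mem_neighbors_comm.1 (h ▸ a))
    rw [Equiv.Perm.mul_apply, Equiv.Perm.mul_apply, Equiv.swap_apply_right,
      Equiv.swap_apply_of_ne_of_ne hyi hyk] at b
    exact h2 y a b
  have symm : ∀ {x y}, (x, y) ∈ conflicts (σ * Equiv.swap i k) →
      (y, x) ∈ conflicts (σ * Equiv.swap i k) := fun h =>
    mem_conflicts.2 ((mem_conflicts.1 h).imp mem_neighbors_comm.1 mem_neighbors_comm.1)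
  refine (Finset.ssubset_iff_of_subset ?_).2 ⟨(i, j), hij, hi j⟩
  rintro ⟨x, y⟩ h
  have hx1 : x ≠ i := by rintro rfl; exact hi _ h
  have hx2 : x ≠ k := by rintro rfl; exact hk' _ h
  have hy1 : y ≠ i := by rintro rfl; exact hi _ (symm h)
  have hy2 : y ≠ k := by rintro rfl; exact hk' _ (symm h)
  simpa [mem_conflicts, Equiv.swap_apply_of_ne_of_ne hx1 hx2,
    Equiv.swap_apply_of_ne_of_ne hy1 hy2] using h

end MatchingPermutation


/-- Let `A` be a finite alphabet and `w₁, w₂ : Fin m → A` two words of the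
same length `m` with equal Parikh images. Suppose every letter occurring in
`w₁` occurs at least 18 times in `w₁`. Then there is a permutation
`σ : [m] → [m]` with `w₁ i = w₂ (σ i)` for all `i`, and no two positions
`i, j` with `|i − j| = 1` and `|σ i − σ j| = 1`. -/
theorem exists_matching_permutation_no_adjacent
    (A : Type) [Fintype A] [DecidableEq A]
    (m : ℕ) (w₁ w₂ : Fin m → A)
    (hparikh : ∀ a : A,
      (Finset.univ.filter (fun i => w₁ i = a)).card =
      (Finset.univ.filter (fun i => w₂ i = a)).card)
    (hfreq : ∀ a : A, (∃ i, w₁ i = a) →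
      18 ≤ (Finset.univ.filter (fun i => w₁ i = a)).card) :
    ∃ σ : Equiv.Perm (Fin m),
      (∀ i, w₁ i = w₂ (σ i)) ∧
      ∀ i j : Fin m, |(i : ℤ) - (j : ℤ)| = 1 → |((σ i : ℕ) : ℤ) - ((σ j : ℕ) : ℤ)| ≠ 1 := by
  classical
  obtain ⟨σ₀, hσ₀⟩ := MatchingPermutation.exists_equiv_of_card_fiber_eq w₁ w₂ hparikh
  obtain ⟨σ, hσ, hmin⟩ := Finset.exists_min_image
    (Finset.univ.filter fun σ : Equiv.Perm (Fin m) => ∀ i, w₁ i = w₂ (σ i))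
    (fun σ => (MatchingPermutation.conflicts σ).card) ⟨σ₀, by simpa using hσ₀⟩
  replace hσ : ∀ i, w₁ i = w₂ (σ i) := by simpa using hσ
  refine ⟨σ, hσ, fun i j hij hσij => ?_⟩
  obtain ⟨k, hkS, hki, hk, h1, h2⟩ := MatchingPermutation.exists_safe_swap σ i
    (Finset.univ.filter fun k => w₁ k = w₁ i)
    (le_trans (by norm_num) (hfreq (w₁ i) ⟨i, rfl⟩))
  have hw : w₁ k = w₁ i := by simpa using hkS
  have hlt := Finset.card_lt_card (MatchingPermutation.conflicts_mul_swap_ssubset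
    (MatchingPermutation.mem_conflicts.2 ⟨MatchingPermutation.mem_neighbors.2 hij,
      MatchingPermutation.mem_neighbors.2 hσij⟩) hki hk h1 h2)
  refine absurd (hmin (σ * Equiv.swap i k) (Finset.mem_filter.2 ⟨Finset.mem_univ _, fun x => ?_⟩))
    (not_le.2 hlt)
  rw [Equiv.Perm.mul_apply, ← hσ]
  by_cases hxi : x = i
  · rw [hxi, Equiv.swap_apply_left, hw]
  by_cases hxk : x = k
  · rw [hxk, Equiv.swap_apply_right, hw]
  · rw [Equiv.swap_apply_of_ne_of_ne hxi hxk]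
end
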